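/- arXiv:2511.19922 — 2 statements merged into one kernel-verified Lean document; each statement's English description precedes it below -/
import Mathlib

section
/- Let α ∈ ℤ₊^n with all α_j ≥ 1, let d = max_j α_j and M = #{j : α_j = d}. Let φ be a C^1 function supported in [-1,1]^n. Then for λ ≥ 2, |∫_{ℝ^n} e^{iλ x₁^{α₁}⋯x_n^{α_n}} φ(x) dx| ≤ C_φ λ^{-1/d} (log λ)^{M-1}. -/
open Real Complex MeasureTheory Finset

/-- First-derivative van der Corput estimate away from the critical point of `t ^ (k + 1)`. -/
lemma norm_intervalIntegral_exp_pow_mul_le (k : ℕ) {μ δ B : ℝ} (hδ0 : 0 < δ) (hδ1 : δ ≤ 1)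
    (hμ : |μ| * δ ^ (k + 1) = 1) {ψ ψ' : ℝ → ℂ} (hψ : ∀ t, HasDerivAt ψ (ψ' t) t)
    (hc : Continuous ψ') (hB : ∀ t, ‖ψ t‖ ≤ B) (hB' : ∀ t, ‖ψ' t‖ ≤ B) :
    ‖∫ t in δ..1, Complex.exp (Complex.I * (μ * t ^ (k + 1) : ℝ)) * ψ t‖ ≤ 4 * B * δ := by
  have hB0 : 0 ≤ B := (norm_nonneg _).trans (hB 0)
  have hμ0 : 0 < |μ| := by
    by_contra h
    have : |μ| = 0 := le_antisymm (not_lt.mp h) (abs_nonneg _)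
    simp [this] at hμ
  have hμne : (μ : ℂ) ≠ 0 := by exact_mod_cast abs_pos.mp hμ0
  have hk : ((k : ℂ) + 1) ≠ 0 := by exact_mod_cast k.succ_ne_zero
  set u : ℝ → ℂ := fun t => Complex.exp (Complex.I * (μ * t ^ (k + 1) : ℝ)) with hu
  set w : ℂ := (Complex.I * μ * (k + 1))⁻¹ with hw
  set r : ℝ → ℝ := fun t => t ^ (-(k : ℤ)) with hr
  set r' : ℝ → ℝ := fun t => ((-(k : ℤ) : ℤ) : ℝ) * t ^ (-(k : ℤ) - 1) with hr'
  have hu1 : ∀ t, ‖u t‖ = 1 := fun t => Complex.norm_exp_I_mul_ofReal _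
  have hud : ∀ t, HasDerivAt u (u t * (Complex.I * (μ * ((k + 1 : ℕ) * t ^ k) : ℝ))) t := by
    intro t
    have h1 : HasDerivAt (fun t : ℝ => μ * t ^ (k + 1)) (μ * ((k + 1 : ℕ) * t ^ k)) t := by
      simpa using (hasDerivAt_pow (k + 1) t).const_mul μ
    exact (h1.ofReal_comp.const_mul Complex.I).cexp
  have huc : Continuous u := by fun_prop
  have hψc : Continuous ψ := continuous_iff_continuousAt.mpr fun t => (hψ t).continuousAt
  have hpos : ∀ t ∈ Set.uIcc δ 1, 0 < t := fun t ht => by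
    rw [Set.uIcc_of_le hδ1] at ht; exact hδ0.trans_le ht.1
  have hrd : ∀ t ∈ Set.uIcc δ 1, HasDerivAt r (r' t) t := fun t ht =>
    hasDerivAt_zpow _ t (Or.inl (hpos t ht).ne')
  have hrc : ContinuousOn r (Set.uIcc δ 1) := fun t ht => (hrd t ht).continuousAt.continuousWithinAt
  have hr'c : ContinuousOn r' (Set.uIcc δ 1) :=
    continuousOn_const.mul fun t ht =>
      (continuousAt_zpow₀ t _ (Or.inl (hpos t ht).ne')).continuousWithinAt
  have hr'0 : ∀ t ∈ Set.uIcc δ 1, r' t ≤ 0 := fun t ht => by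
    have := zpow_nonneg (hpos t ht).le (-(k : ℤ) - 1)
    simp only [hr']
    push_cast
    nlinarith [Nat.cast_nonneg (α := ℝ) k]
  have hr0 : ∀ t ∈ Set.uIcc δ 1, 0 ≤ r t := fun t ht => zpow_nonneg (hpos t ht).le _
  have hrle : ∀ t ∈ Set.uIcc δ 1, r t ≤ r δ := fun t ht => by
    have h2 := ht
    rw [Set.uIcc_of_le hδ1] at h2
    simp only [hr, zpow_neg, zpow_natCast]
    gcongr
    exact h2.1
  set R : ℝ → ℂ := fun t => w * (u t * (ψ' t * (r t : ℂ) + ψ t * (r' t : ℂ))) with hR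
  have hRc : ContinuousOn R (Set.uIcc δ 1) := by
    refine continuousOn_const.mul (huc.continuousOn.mul ((hc.continuousOn.mul ?_).add
      (hψc.continuousOn.mul ?_)))
    · exact Complex.continuous_ofReal.comp_continuousOn hrc
    · exact Complex.continuous_ofReal.comp_continuousOn hr'c
  have hG : ∀ t ∈ Set.uIcc δ 1,
      HasDerivAt (fun t => w * (u t * (ψ t * (r t : ℂ)))) (u t * ψ t + R t) t := by
    intro t ht
    have h := ((hud t).mul ((hψ t).mul (hrd t ht).ofReal_comp)).const_mul w
    refine h.congr_deriv ?_
    have hrt : (r t : ℂ) * (t : ℂ) ^ k = 1 := by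
      have : t ≠ 0 := (hpos t ht).ne'
      simp only [hr, zpow_neg, zpow_natCast]
      norm_cast
      field_simp
    have hww : w * (Complex.I * μ * (k + 1)) = 1 :=
      inv_mul_cancel₀ (mul_ne_zero (mul_ne_zero Complex.I_ne_zero hμne) hk)
    simp only [hR, Pi.mul_apply]
    push_cast
    linear_combination (u t * ψ t) * hww + (w * (Complex.I * μ * (k + 1)) * u t * ψ t) * hrt
  have hint1 : IntervalIntegrable (fun t => u t * ψ t) volume δ 1 :=
    (huc.mul hψc).intervalIntegrable _ _
  have hint2 : IntervalIntegrable R volume δ 1 := hRc.intervalIntegrable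
  have key := intervalIntegral.integral_eq_sub_of_hasDerivAt hG (hint1.add hint2)
  rw [intervalIntegral.integral_add hint1 hint2] at key
  have hGn : ∀ t ∈ Set.uIcc δ 1, ‖w * (u t * (ψ t * (r t : ℂ)))‖ ≤ ‖w‖ * (B * r δ) := by
    intro t ht
    rw [norm_mul, norm_mul, norm_mul, hu1, one_mul, Complex.norm_real, Real.norm_eq_abs,
      abs_of_nonneg (hr0 t ht)]
    have := hrle t ht
    have := hr0 t ht
    have := hB t
    gcongr
  have hr'int : IntervalIntegrable r' volume δ 1 := hr'c.intervalIntegrable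
  have hRn : ‖∫ t in δ..1, R t‖ ≤ ‖w‖ * (B * (2 * r δ)) := by
    have h1 : ‖∫ t in δ..1, R t‖ ≤ ∫ t in δ..1, ‖w‖ * B * (r δ - r' t) := by
      refine intervalIntegral.norm_integral_le_of_norm_le hδ1 (Filter.Eventually.of_forall ?_)
        ((intervalIntegrable_const.sub hr'int).const_mul _)
      intro t ht
      have ht' : t ∈ Set.uIcc δ 1 := by rw [Set.uIcc_of_le hδ1]; exact Set.Ioc_subset_Icc_self ht
      rw [hR, norm_mul, norm_mul, hu1, one_mul, mul_assoc]
      gcongr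
      refine (norm_add_le _ _).trans ?_
      rw [norm_mul, norm_mul, Complex.norm_real, Complex.norm_real, Real.norm_eq_abs,
        Real.norm_eq_abs, abs_of_nonneg (hr0 t ht'), abs_of_nonpos (hr'0 t ht')]
      have a1 := mul_le_mul (hB' t) (hrle t ht') (hr0 t ht') hB0
      have a2 := mul_le_mul_of_nonneg_right (hB t) (neg_nonneg.mpr (hr'0 t ht'))
      linarith
    refine h1.trans ?_
    rw [intervalIntegral.integral_const_mul, intervalIntegral.integral_sub
      intervalIntegrable_const hr'int, intervalIntegral.integral_const,
      intervalIntegral.integral_eq_sub_of_hasDerivAt hrd hr'int, smul_eq_mul, mul_assoc]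
    have b1 := hr0 δ Set.left_mem_uIcc
    have b2 := hr0 1 Set.right_mem_uIcc
    gcongr
    nlinarith
  have hwr : ‖w‖ * r δ ≤ δ := by
    have e1 : ‖w‖ = (|μ| * (k + 1))⁻¹ := by
      rw [hw, norm_inv, norm_mul, norm_mul, Complex.norm_I, Complex.norm_real, one_mul,
        Real.norm_eq_abs]
      norm_cast
    have e2 : r δ = |μ| * δ := by
      simp only [hr, zpow_neg, zpow_natCast]
      field_simp
      rw [← hμ]; ring
    rw [e1, e2, inv_mul_le_iff₀ (by positivity)]
    nlinarith [mul_nonneg (mul_nonneg hμ0.le hδ0.le) (Nat.cast_nonneg (α := ℝ) k)]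
  have e : ∫ t in δ..1, u t * ψ t = w * (u 1 * (ψ 1 * (r 1 : ℂ))) - w * (u δ * (ψ δ * (r δ : ℂ)))
      - ∫ t in δ..1, R t := by rw [← key]; ring
  rw [e]
  have n1 := norm_sub_le (w * (u 1 * (ψ 1 * (r 1 : ℂ))) - w * (u δ * (ψ δ * (r δ : ℂ))))
    (∫ t in δ..1, R t)
  have n2 := norm_sub_le (w * (u 1 * (ψ 1 * (r 1 : ℂ)))) (w * (u δ * (ψ δ * (r δ : ℂ))))
  have n3 := hGn 1 Set.right_mem_uIcc
  have n4 := hGn δ Set.left_mem_uIcc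
  nlinarith [mul_le_mul_of_nonneg_left hwr hB0]

/-- Decay of a one-dimensional oscillatory integral with phase `μ t ^ (k + 1)`, with any exponent
up to the sharp one. -/
lemma norm_integral_exp_pow_mul_le (k : ℕ) {μ s B : ℝ} (hμ : μ ≠ 0) (hs0 : 0 ≤ s)
    (hs : s ≤ 1 / (k + 1 : ℕ)) {ψ ψ' : ℝ → ℂ} (hψ : ∀ t, HasDerivAt ψ (ψ' t) t)
    (hc : Continuous ψ') (hB : ∀ t, ‖ψ t‖ ≤ B) (hB' : ∀ t, ‖ψ' t‖ ≤ B)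
    (hsupp : ∀ t, t ∉ Set.Icc (-1 : ℝ) 1 → ψ t = 0) :
    ‖∫ t : ℝ, Complex.exp (Complex.I * (μ * t ^ (k + 1) : ℝ)) * ψ t‖ ≤ 10 * B * |μ| ^ (-s) := by
  have hB0 : 0 ≤ B := (norm_nonneg _).trans (hB 0)
  have hψc : Continuous ψ := continuous_iff_continuousAt.mpr fun t => (hψ t).continuousAt
  have hμ0 : 0 < |μ| := abs_pos.mpr hμ
  set f : ℝ → ℂ := fun t => Complex.exp (Complex.I * (μ * t ^ (k + 1) : ℝ)) * ψ t with hf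
  have hfc : Continuous f := by fun_prop
  have hfB : ∀ t, ‖f t‖ ≤ B := fun t => by
    simpa only [hf, norm_mul, Complex.norm_exp_I_mul_ofReal, one_mul] using hB t
  have hfi : ∫ t, f t = ∫ t in (-1)..1, f t := by
    rw [intervalIntegral.integral_of_le (by norm_num), ← integral_Icc_eq_integral_Ioc,
      setIntegral_eq_integral_of_forall_compl_eq_zero]
    intro t ht
    simp [hf, hsupp t ht]
  rw [hfi]
  rcases le_or_gt |μ| 1 with h1 | h1
  · have a := intervalIntegral.norm_integral_le_of_norm_le_const (f := f) (a := -1) (b := 1)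
      fun t _ => hfB t
    have b := Real.one_le_rpow_of_pos_of_le_one_of_nonpos hμ0 h1 (neg_nonpos.mpr hs0)
    norm_num at a
    nlinarith
  set δ : ℝ := |μ| ^ (-(1 / (k + 1 : ℕ) : ℝ)) with hδ
  have hδ0 : 0 < δ := Real.rpow_pos_of_pos hμ0 _
  have hδ1 : δ ≤ 1 := Real.rpow_le_one_of_one_le_of_nonpos h1.le
    (by rw [neg_nonpos]; positivity)
  have hδs : δ ≤ |μ| ^ (-s) := Real.rpow_le_rpow_of_exponent_le h1.le (neg_le_neg hs)
  have hμδ : |μ| * δ ^ (k + 1) = 1 := by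
    rw [hδ, ← Real.rpow_natCast, ← Real.rpow_mul hμ0.le, neg_mul,
      one_div_mul_cancel (by positivity), Real.rpow_neg_one, mul_inv_cancel₀ hμ0.ne']
  have hr := norm_intervalIntegral_exp_pow_mul_le k hδ0 hδ1 hμδ hψ hc hB hB'
  have hl := norm_intervalIntegral_exp_pow_mul_le k (μ := μ * (-1) ^ (k + 1)) hδ0 hδ1
    (by simpa [abs_mul] using hμδ)
    (ψ := fun t => ψ (-t)) (ψ' := fun t => -ψ' (-t))
    (fun t => by simpa [Function.comp_def] using (hψ (-t)).scomp t (hasDerivAt_neg t)) (by fun_prop)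
    (fun t => hB _) (fun t => by simpa using hB' _)
  have hl' : ‖∫ t in (-1)..(-δ), f t‖ ≤ 4 * B * δ := by
    rw [← intervalIntegral.integral_comp_neg]
    convert hl using 4 with t
    simp only [hf]
    rw [neg_pow t, mul_assoc]
  have hm := intervalIntegral.norm_integral_le_of_norm_le_const (f := f) (a := -δ) (b := δ)
      fun t _ => hfB t
  have hi : ∀ a b, IntervalIntegrable f volume a b := fun a b => hfc.intervalIntegrable a b
  rw [← intervalIntegral.integral_add_adjacent_intervals (hi (-1) (-δ)) (hi (-δ) 1),
    ← intervalIntegral.integral_add_adjacent_intervals (hi (-δ) δ) (hi δ 1)]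
  rw [sub_neg_eq_add, abs_of_pos (by linarith)] at hm
  have n1 := norm_add_le (∫ t in (-1)..(-δ), f t) ((∫ t in (-δ)..δ, f t) + ∫ t in δ..1, f t)
  have n2 := norm_add_le (∫ t in (-δ)..δ, f t) (∫ t in δ..1, f t)
  have := mul_le_mul_of_nonneg_left hδs hB0
  have hr2 : ‖∫ t in δ..1, f t‖ ≤ 4 * B * δ := hr
  linarith

lemma integral_indicator_abs_rpow {s : ℝ} (hs : s < 1) :
    ∫ t : ℝ, (Set.Iic (1 : ℝ)).indicator (fun t => t ^ (-s)) |t| = 2 / (1 - s) := by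
  rw [integral_comp_abs, setIntegral_indicator measurableSet_Iic, Set.Ioi_inter_Iic,
    ← intervalIntegral.integral_of_le zero_le_one, integral_rpow (Or.inl (by linarith)),
    Real.one_rpow, Real.zero_rpow (by linarith)]
  rw [sub_zero, neg_add_eq_sub, mul_one_div]

lemma integrable_indicator_abs_rpow {s : ℝ} (hs : s < 1) :
    Integrable fun t : ℝ => (Set.Iic (1 : ℝ)).indicator (fun t => t ^ (-s)) |t| := by
  refine Integrable.of_integral_ne_zero ?_
  rw [integral_indicator_abs_rpow hs]
  exact div_ne_zero two_ne_zero (by linarith)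

lemma prod_abs_pow_rpow {ι : Type*} [Fintype ι] (x : ι → ℝ) (β : ι → ℕ) (s : ℝ) :
    |∏ j, x j ^ β j| ^ (-s) = ∏ j, |x j| ^ (-(β j * s)) := by
  rw [Finset.abs_prod, ← Real.finsetProd_rpow _ _ fun _ _ => abs_nonneg _]
  refine Finset.prod_congr rfl fun j _ => ?_
  rw [abs_pow, ← Real.rpow_natCast, ← Real.rpow_mul (abs_nonneg _), mul_neg]

lemma ae_forall_coord_ne_zero (m : ℕ) : ∀ᵐ x : Fin m → ℝ, ∀ j, x j ≠ 0 := by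
  refine ae_all_iff.mpr fun j => ?_
  exact (Measure.quasiMeasurePreserving_eval (fun _ : Fin m => (volume : Measure ℝ)) j).ae
    (Measure.ae_ne volume 0)

lemma integral_insertNth {m : ℕ} (i : Fin (m + 1)) {F : (Fin (m + 1) → ℝ) → ℂ}
    (hF : Integrable F) :
    ∫ x, F x = ∫ y : Fin m → ℝ, ∫ t : ℝ, F (i.insertNth t y) := by
  have hem := (volume_preserving_piFinSuccAbove (fun _ : Fin (m + 1) => ℝ) i).symm
  rw [← hem.integral_comp', Measure.volume_eq_prod, integral_prod_symm]
  · rfl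
  · exact (hem.integrable_comp_emb (MeasurableEquiv.measurableEmbedding _)).mpr hF

lemma hasDerivAt_insertNth {m : ℕ} (i : Fin (m + 1)) (y : Fin m → ℝ) (t : ℝ) :
    HasDerivAt (fun t : ℝ => (i.insertNth t y : Fin (m + 1) → ℝ)) (Pi.single i 1) t := by
  have := hasDerivAt_update (i.insertNth 0 y : Fin (m + 1) → ℝ) i t
  convert this using 2
  rw [Fin.update_insertNth]

/-- Freezing all coordinates but one, which carries the exponent `k + 1`, the van der Corput bound
gives decay in the remaining coordinates. -/
lemma norm_integral_monomial_phase_slice_le {m k : ℕ} (i : Fin (m + 1)) (α : Fin (m + 1) → ℕ)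
    (hi : α i = k + 1) {φ : (Fin (m + 1) → ℝ) → ℂ} (hφ : ContDiff ℝ 1 φ)
    (hsupp : tsupport φ ⊆ Set.pi Set.univ fun _ => Set.Icc (-1 : ℝ) 1) {B : ℝ}
    (hB : ∀ x, ‖φ x‖ ≤ B) (hB' : ∀ x, ‖fderiv ℝ φ x‖ ≤ B) {lam s : ℝ} (hlam : 0 < lam)
    (hs0 : 0 ≤ s) (hs : s ≤ 1 / (k + 1 : ℕ)) {y : Fin m → ℝ} (hy : ∀ j, y j ≠ 0) :
    ‖∫ t : ℝ, Complex.exp (Complex.I * lam *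
        ∏ j, (i.insertNth t y : Fin (m + 1) → ℝ) j ^ α j) * φ (i.insertNth t y)‖ ≤
      10 * B * lam ^ (-s) * ∏ j, (Set.Iic (1 : ℝ)).indicator
        (fun t => t ^ (-(α (i.succAbove j) * s))) |y j| := by
  have hB0 : 0 ≤ B := (norm_nonneg _).trans (hB 0)
  have hφ0 : ∀ x : Fin (m + 1) → ℝ, ∀ j, x j ∉ Set.Icc (-1 : ℝ) 1 → φ x = 0 := fun x j hj =>
    image_eq_zero_of_notMem_tsupport fun h => hj (hsupp h j trivial)
  by_cases hy1 : ∀ j, |y j| ≤ 1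
  · have hP : ∏ j, y j ^ α (i.succAbove j) ≠ 0 :=
      Finset.prod_ne_zero_iff.mpr fun j _ => pow_ne_zero _ (hy j)
    have h := norm_integral_exp_pow_mul_le k (mul_ne_zero hlam.ne' hP) hs0 hs
      (ψ := fun t => φ (i.insertNth t y))
      (fun t => ((hφ.differentiable one_ne_zero _).hasFDerivAt.comp_hasDerivAt t
        (hasDerivAt_insertNth i y t)))
      (by
        have := hφ.continuous_fderiv one_ne_zero
        have h2 : Continuous fun t : ℝ => (i.insertNth t y : Fin (m + 1) → ℝ) :=
          continuous_iff_continuousAt.mpr fun t => (hasDerivAt_insertNth i y t).continuousAt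
        fun_prop)
      (fun t => hB _)
      (fun t => by
        refine (ContinuousLinearMap.le_opNorm _ _).trans ?_
        rw [Pi.norm_single, norm_one, mul_one]
        exact hB' _)
      (fun t ht => hφ0 _ i (by simpa using ht))
    rw [abs_mul, abs_of_pos hlam, Real.mul_rpow hlam.le (abs_nonneg _), prod_abs_pow_rpow,
      ← mul_assoc] at h
    convert h using 2
    · congr 1 with t
      rw [Fin.prod_univ_succAbove _ i, hi]
      simp only [Fin.insertNth_apply_same, Fin.insertNth_apply_succAbove]
      push_cast
      ring_nf
    · exact Finset.prod_congr rfl fun j _ =>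
        Set.indicator_of_mem (Set.mem_Iic.mpr (hy1 j)) _
  · push Not at hy1
    obtain ⟨j, hj⟩ := hy1
    have : ∀ t : ℝ, φ (i.insertNth t y) = 0 := fun t => hφ0 _ (i.succAbove j) (by
      rw [Fin.insertNth_apply_succAbove, Set.mem_Icc, ← abs_le]
      exact not_le.mpr hj)
    simp only [this, mul_zero, integral_zero, norm_zero]
    have h2 : 0 ≤ ∏ j, (Set.Iic (1 : ℝ)).indicator
        (fun t => t ^ (-(α (i.succAbove j) * s))) |y j| :=
      Finset.prod_nonneg fun j _ => by
        unfold Set.indicator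
        split_ifs
        · exact Real.rpow_nonneg (abs_nonneg _) _
        · exact le_rfl
    positivity

lemma norm_integral_monomial_phase_le {m k : ℕ} (i : Fin (m + 1)) (α : Fin (m + 1) → ℕ)
    (hi : α i = k + 1) {φ : (Fin (m + 1) → ℝ) → ℂ} (hφ : ContDiff ℝ 1 φ)
    (hsupp : tsupport φ ⊆ Set.pi Set.univ fun _ => Set.Icc (-1 : ℝ) 1) {B : ℝ}
    (hB : ∀ x, ‖φ x‖ ≤ B) (hB' : ∀ x, ‖fderiv ℝ φ x‖ ≤ B) {lam s : ℝ} (hlam : 0 < lam)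
    (hs0 : 0 ≤ s) (hs : s ≤ 1 / (k + 1 : ℕ)) (hαs : ∀ j, α (i.succAbove j) * s < 1) :
    ‖∫ x : Fin (m + 1) → ℝ, Complex.exp (Complex.I * lam * ∏ j, x j ^ α j) * φ x‖ ≤
      10 * B * lam ^ (-s) * ∏ j, 2 / (1 - α (i.succAbove j) * s) := by
  have hφs : HasCompactSupport φ :=
    (isCompact_univ_pi fun _ => isCompact_Icc).of_isClosed_subset (isClosed_tsupport _) hsupp
  have hφc := hφ.continuous
  have hint : Integrable fun x : Fin (m + 1) → ℝ =>
      Complex.exp (Complex.I * lam * ∏ j, x j ^ α j) * φ x :=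
    Continuous.integrable_of_hasCompactSupport (by fun_prop) hφs.mul_left
  rw [integral_insertNth i hint]
  refine (norm_integral_le_of_norm_le ((Integrable.fintype_prod fun j =>
    integrable_indicator_abs_rpow (hαs j)).const_mul (10 * B * lam ^ (-s)))
    ((ae_forall_coord_ne_zero m).mono fun y hy =>
      norm_integral_monomial_phase_slice_le i α hi hφ hsupp hB hB' hlam hs0 hs hy)).trans ?_
  have h := integral_fintype_prod_eq_prod (μ := fun _ : Fin m => (volume : Measure ℝ))
    fun j t => (Set.Iic (1 : ℝ)).indicator (fun t => t ^ (-(α (i.succAbove j) * s))) |t|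
  rw [integral_const_mul, h]
  simp only [integral_indicator_abs_rpow (hαs _), le_refl]

/-- Decay estimate for an oscillatory integral with monomial phase `x^α`:
`|∫ e^{iλ x^α} φ| ≤ C_φ λ^{-1/d} (log λ)^{M-1}` with `d = max_j α_j`,
`M = #{j : α_j = d}`, for φ a C¹ function supported in `[-1,1]^n`. -/
theorem oscillatory_monomial_phase (n : ℕ) (α : Fin n → ℕ) (hα : ∀ j, 1 ≤ α j)
    (d : ℕ) (hd : d = Finset.univ.sup α) (hdpos : 0 < d)
    (M : ℕ) (hM : M = (Finset.univ.filter fun j => α j = d).card)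
    (φ : (Fin n → ℝ) → ℂ) (hφ : ContDiff ℝ 1 φ)
    (hsupp : tsupport φ ⊆ Set.pi Set.univ fun _ => Set.Icc (-1:ℝ) 1) :
    ∃ C : ℝ, 0 < C ∧ ∀ lam : ℝ, 2 ≤ lam →
      ‖∫ x : Fin n → ℝ, Complex.exp (Complex.I * lam * ∏ j, x j ^ α j) * φ x‖ ≤
        C * lam ^ (-(1:ℝ)/d) * Real.log lam ^ (M - 1) := by
  rcases n with _ | m
  · simp [hd] at hdpos
  obtain ⟨k, rfl⟩ : ∃ k, d = k + 1 := ⟨d - 1, by omega⟩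
  obtain ⟨i, -, hi⟩ := Finset.exists_mem_eq_sup Finset.univ Finset.univ_nonempty α
  rw [← hd] at hi
  have hle : ∀ j, α j ≤ k + 1 := fun j => hd ▸ Finset.le_sup (Finset.mem_univ j)
  have hφs : HasCompactSupport φ :=
    (isCompact_univ_pi fun _ => isCompact_Icc).of_isClosed_subset (isClosed_tsupport _) hsupp
  obtain ⟨B₁, hB₁⟩ := hφs.exists_bound_of_continuous hφ.continuous
  obtain ⟨B₂, hB₂⟩ := (hφs.fderiv ℝ).exists_bound_of_continuous (hφ.continuous_fderiv one_ne_zero)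
  set B := max 1 (max B₁ B₂) with hBdef
  have hB0 : 0 < B := zero_lt_one.trans_le (le_max_left _ _)
  have hB : ∀ x, ‖φ x‖ ≤ B := fun x => (hB₁ x).trans (by simp [hBdef])
  have hB' : ∀ x, ‖fderiv ℝ φ x‖ ≤ B := fun x => (hB₂ x).trans (by simp [hBdef])
  have hM' : M - 1 = (Finset.univ.filter fun j => α (i.succAbove j) = k + 1).card := by
    rw [hM, Finset.card_filter, Finset.card_filter, Fin.sum_univ_succAbove _ i, if_pos hi.symm]
    omega
  set N := (Finset.univ.filter fun j => ¬ α (i.succAbove j) = k + 1).card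
  have hlog2 : 0 < Real.log 2 := Real.log_pos one_lt_two
  refine ⟨20 * B * (4 / Real.log 2) ^ (M - 1) * (2 * (k + 1 : ℕ)) ^ N, by positivity,
    fun lam hlam => ?_⟩
  have hlam0 : 0 < lam := by linarith
  have hL : Real.log 2 ≤ Real.log lam := Real.log_le_log two_pos hlam
  have hL0 : 0 < Real.log lam := hlog2.trans_le hL
  set ε : ℝ := Real.log 2 / (2 * Real.log lam) with hε
  have hε0 : 0 < ε := by positivity
  have hε1 : ε ≤ 1 / 2 := by
    rw [hε, div_le_iff₀ (by positivity)]; linarith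
  have hD : (0 : ℝ) < (k + 1 : ℕ) := by positivity
  have hD1 : (1 : ℝ) ≤ (k + 1 : ℕ) := by exact_mod_cast Nat.le_add_left 1 k
  set s : ℝ := (1 - ε) / (k + 1 : ℕ) with hs
  have hs0 : 0 ≤ s := div_nonneg (by linarith) hD.le
  have hs1 : s ≤ 1 / (k + 1 : ℕ) := by rw [hs]; gcongr; linarith
  have hDs : ((k + 1 : ℕ) : ℝ) * s = 1 - ε := mul_div_cancel₀ _ hD.ne'
  have hαs : ∀ j, (α (i.succAbove j) : ℝ) * s < 1 := fun j => by
    have : (α (i.succAbove j) : ℝ) ≤ (k + 1 : ℕ) := by exact_mod_cast hle _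
    nlinarith
  refine (norm_integral_monomial_phase_le i α hi.symm hφ hsupp hB hB' hlam0 hs0 hs1 hαs).trans ?_
  have hpow : lam ^ (-s) ≤ lam ^ (-(1 : ℝ) / (k + 1 : ℕ)) * 2 := by
    have e : -s = -(1 : ℝ) / (k + 1 : ℕ) + ε / (k + 1 : ℕ) := by rw [hs]; ring
    rw [e, Real.rpow_add hlam0]
    gcongr
    have h2 : ε / (k + 1 : ℕ) ≤ ε := div_le_self hε0.le hD1
    calc lam ^ (ε / (k + 1 : ℕ)) ≤ lam ^ ε := Real.rpow_le_rpow_of_exponent_le (by linarith) h2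
      _ = Real.exp (Real.log 2 / 2) := by
        rw [Real.rpow_def_of_pos hlam0, hε]; congr 1; field_simp
      _ ≤ Real.exp (Real.log 2) := Real.exp_le_exp.mpr (by linarith)
      _ = 2 := Real.exp_log two_pos
  have hprod : ∏ j, 2 / (1 - α (i.succAbove j) * s) ≤
      (4 / Real.log 2 * Real.log lam) ^ (M - 1) * (2 * (k + 1 : ℕ)) ^ N := by
    calc ∏ j, 2 / (1 - α (i.succAbove j) * s)
        ≤ ∏ j, if α (i.succAbove j) = k + 1 then 4 / Real.log 2 * Real.log lam
          else 2 * ((k + 1 : ℕ) : ℝ) := by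
          refine Finset.prod_le_prod (fun j _ => ?_) fun j _ => ?_
          · exact div_nonneg two_pos.le (by linarith [hαs j])
          · split_ifs with hj
            · rw [hj, hDs, hε]
              apply le_of_eq
              field_simp
              norm_num
            · have h1 : (α (i.succAbove j) : ℝ) + 1 ≤ (k + 1 : ℕ) := by
                exact_mod_cast Nat.lt_of_le_of_ne (hle _) hj
              rw [div_le_iff₀ (by linarith [hαs j])]
              have h3 : 1 ≤ ((k + 1 : ℕ) : ℝ) * (1 - α (i.succAbove j) * s) := by
                nlinarith [mul_nonneg (Nat.cast_nonneg (α := ℝ) (α (i.succAbove j))) hε0.le]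
              linarith
      _ = _ := by rw [Finset.prod_ite, Finset.prod_const, Finset.prod_const, ← hM']
  calc 10 * B * lam ^ (-s) * ∏ j, 2 / (1 - α (i.succAbove j) * s)
      ≤ 10 * B * (lam ^ (-(1 : ℝ) / (k + 1 : ℕ)) * 2) *
        ((4 / Real.log 2 * Real.log lam) ^ (M - 1) * (2 * (k + 1 : ℕ)) ^ N) := by
        gcongr
        exact Finset.prod_nonneg fun j _ => div_nonneg two_pos.le (by linarith [hαs j])
    _ = _ := by rw [mul_pow]; ring
end

section
/- Let α, β ∈ ℤ₊^n with α_j ≥ 1 for all j, let d = max_j α_j/(β_j + 1) and M = #{j : α_j/(β_j+1) = d}, and suppose d ≥ 1. Let φ be C^1 supported in [-1,1]^n. Then for λ ≥ 2, |∫_{ℝ^n} e^{iλ x₁^{α₁}⋯x_n^{α_n}} |x₁^{β₁}⋯x_n^{β_n}| φ(x) dx| ≤ C_φ λ^{-1/d} (log λ)^{M-1}. -/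
open Real Complex MeasureTheory Finset

/-- Integration by parts bound away from the critical point of the phase. -/
theorem norm_integral_exp_monomial_tail_le {b k : ℕ} {s δ B : ℝ} (hs : s ≠ 0) (hδ : 0 < δ)
    (hδ1 : δ ≤ 1) {f : ℝ → ℂ} (hf : ContDiff ℝ 1 f) (hB : ∀ t, ‖f t‖ ≤ B)
    (hB' : ∀ t, ‖deriv f t‖ ≤ B) :
    ‖∫ t in δ..1, Complex.exp (I * s * (t : ℂ) ^ (k + b + 1)) * (t : ℂ) ^ b * f t‖ ≤
      4 * B / (|s| * δ ^ k) := by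
  have hB0 : 0 ≤ B := (norm_nonneg _).trans (hB 0)
  have hpos : ∀ t ∈ Set.uIcc δ 1, 0 < t := fun t ht => by
    rw [Set.uIcc_of_le hδ1] at ht; exact hδ.trans_le ht.1
  set a : ℕ := k + b + 1 with ha
  have haC : (a : ℂ) ≠ 0 := by simp [ha]; norm_cast
  have hsC : (s : ℂ) ≠ 0 := by exact_mod_cast hs
  set r : ℝ → ℝ := fun t => (t ^ k)⁻¹ with hr
  set r' : ℝ → ℝ := fun t => -(k * t ^ (k - 1)) / (t ^ k) ^ 2 with hr'
  set v : ℝ → ℂ := fun t => Complex.exp (I * s * (t : ℂ) ^ a) / (I * s * a) with hv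
  set v' : ℝ → ℂ := fun t => Complex.exp (I * s * (t : ℂ) ^ a) * (t : ℂ) ^ (a - 1) with hv'
  have hrd : ∀ t ∈ Set.uIcc δ 1, HasDerivAt r (r' t) t := fun t ht =>
    (hasDerivAt_pow k t).inv (pow_ne_zero _ (hpos t ht).ne')
  have hfd : ∀ t, HasDerivAt f (deriv f t) t := fun t =>
    (hf.differentiable one_ne_zero t).hasDerivAt
  have hfc : Continuous (deriv f) := hf.continuous_deriv le_rfl
  have hvd : ∀ t, HasDerivAt v (v' t) t := fun t => by
    have h1 : HasDerivAt (fun z : ℂ => Complex.exp (I * s * z ^ a) / (I * s * a))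
        (Complex.exp (I * s * (t : ℂ) ^ a) * (I * s * (a * (t : ℂ) ^ (a - 1))) / (I * s * a)) t :=
      (((hasDerivAt_pow a (t : ℂ)).const_mul (I * s)).cexp).div_const _
    convert h1.comp_ofReal using 1
    have := I_ne_zero
    simp only [hv']
    field_simp
  have hr'c : ContinuousOn r' (Set.uIcc δ 1) := by
    refine ContinuousOn.div (by fun_prop) (by fun_prop) fun t ht => ?_
    have := hpos t ht
    positivity
  have hrc : ContinuousOn r (Set.uIcc δ 1) := fun t ht => (hrd t ht).continuousAt.continuousWithinAt
  have hv'c : Continuous v' := by fun_prop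
  have hvnorm : ∀ t, ‖v t‖ ≤ |s|⁻¹ := fun t => by
    have h1 : ‖Complex.exp (I * s * (t : ℂ) ^ a)‖ = 1 := by
      have : I * s * (t : ℂ) ^ a = ((s * t ^ a : ℝ) : ℂ) * I := by push_cast; ring
      rw [this, Complex.norm_exp_ofReal_mul_I]
    simp only [hv, norm_div, norm_mul, h1, norm_I, Complex.norm_real, Complex.norm_natCast,
      Real.norm_eq_abs, one_mul, one_div]
    have h2 : (1 : ℝ) ≤ a := by simp [ha]; positivity
    have h3 : 0 < |s| := abs_pos.2 hs
    gcongr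
    nlinarith
  have key := intervalIntegral.integral_mul_deriv_eq_deriv_mul
    (u := fun t => r t • f t) (v := v) (u' := fun t => r t • deriv f t + r' t • f t) (v' := v')
    (a := δ) (b := 1) (fun t ht => (hrd t ht).smul (hfd t)) (fun t _ => hvd t)
    (((hrc.smul hfc.continuousOn).add (hr'c.smul hf.continuous.continuousOn)).intervalIntegrable)
    (hv'c.intervalIntegrable _ _)
  have hlhs : ∫ t in δ..1, Complex.exp (I * s * (t : ℂ) ^ a) * (t : ℂ) ^ b * f t =
      ∫ t in δ..1, (r t • f t) * v' t := by
    refine intervalIntegral.integral_congr fun t ht => ?_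
    have h0 : (t : ℂ) ≠ 0 := by exact_mod_cast (hpos t ht).ne'
    have h1 : a - 1 = k + b := by omega
    simp only [hr, hv', h1, real_smul, pow_add]
    push_cast
    field_simp
  rw [hlhs, key]
  have hrle : ∀ t ∈ Set.Icc δ 1, 0 ≤ r t ∧ r t ≤ r δ := fun t ht => by
    have := hδ.trans_le ht.1
    refine ⟨by simp only [hr]; positivity, ?_⟩
    simp only [hr]
    gcongr
    exact ht.1
  have hr'neg : ∀ t ∈ Set.Icc δ 1, r' t ≤ 0 := fun t ht => by
    have := hδ.trans_le ht.1
    simp only [hr', neg_div]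
    rw [neg_nonpos]
    positivity
  have hub : ∀ t ∈ Set.Icc δ 1, ‖r t • f t‖ ≤ r δ * B := fun t ht => by
    rw [norm_smul, Real.norm_of_nonneg (hrle t ht).1]
    exact mul_le_mul (hrle t ht).2 (hB t) (norm_nonneg _) ((hrle t ht).1.trans (hrle t ht).2)
  have hbd : ∀ t ∈ Set.Icc δ 1, ‖(r t • f t) * v t‖ ≤ r δ * B * |s|⁻¹ := fun t ht => by
    rw [norm_mul]
    exact mul_le_mul (hub t ht) (hvnorm t) (norm_nonneg _) ((norm_nonneg _).trans (hub t ht))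
  have hint : ‖∫ t in δ..1, (r t • deriv f t + r' t • f t) * v t‖ ≤
      ∫ t in δ..1, (r δ - r' t) * (B * |s|⁻¹) := by
    refine intervalIntegral.norm_integral_le_of_norm_le hδ1 (ae_of_all _ fun t ht => ?_)
      (((continuousOn_const.sub hr'c).mul continuousOn_const).intervalIntegrable)
    have ht' : t ∈ Set.Icc δ 1 := Set.Ioc_subset_Icc_self ht
    have h0 := hrle t ht'
    have h1 := hr'neg t ht'
    rw [norm_mul, ← mul_assoc]
    refine mul_le_mul ?_ (hvnorm t) (norm_nonneg _) (mul_nonneg (by linarith) hB0)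
    refine (norm_add_le _ _).trans ?_
    rw [norm_smul, norm_smul, Real.norm_of_nonneg h0.1, Real.norm_of_nonpos h1, sub_eq_add_neg, add_mul]
    refine add_le_add (mul_le_mul h0.2 (hB' t) (norm_nonneg _) (by linarith)) ?_
    exact mul_le_mul_of_nonneg_left (hB t) (by linarith)
  have hr'i : IntervalIntegrable r' volume δ 1 := hr'c.intervalIntegrable
  rw [intervalIntegral.integral_mul_const, intervalIntegral.integral_sub (by simp) hr'i,
    intervalIntegral.integral_eq_sub_of_hasDerivAt hrd hr'i,
    intervalIntegral.integral_const, smul_eq_mul] at hint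
  have h1 := hbd 1 ⟨hδ1, le_rfl⟩
  have h2 := hbd δ ⟨le_rfl, hδ1⟩
  have h3 : 4 * B / (|s| * δ ^ k) = 4 * (r δ * B * |s|⁻¹) := by
    simp only [hr]; field_simp
  rw [h3]
  have hrδ : 0 ≤ r δ := (hrle δ ⟨le_rfl, hδ1⟩).1
  have hr1 : 0 ≤ r 1 := (hrle 1 ⟨hδ1, le_rfl⟩).1
  have h4 : ((1 - δ) * r δ - (r 1 - r δ)) * (B * |s|⁻¹) ≤ 2 * r δ * (B * |s|⁻¹) :=
    mul_le_mul_of_nonneg_right (by nlinarith) (by positivity)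
  refine (norm_sub_le _ _).trans ?_
  have h5 := norm_sub_le (r 1 • f 1 * v 1) (r δ • f δ * v δ)
  linarith

/-- Decay of a one-dimensional damped oscillatory integral over the half interval `[0, 1]`. -/
theorem norm_integral_exp_monomial_zero_one_le {b k : ℕ} {s B : ℝ} {f : ℝ → ℂ}
    (hf : ContDiff ℝ 1 f) (hB : ∀ t, ‖f t‖ ≤ B) (hB' : ∀ t, ‖deriv f t‖ ≤ B) :
    ‖∫ t in (0:ℝ)..1, Complex.exp (I * s * (t : ℂ) ^ (k + b + 1)) * (t : ℂ) ^ b * f t‖ ≤ B ∧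
    (s ≠ 0 →
      ‖∫ t in (0:ℝ)..1, Complex.exp (I * s * (t : ℂ) ^ (k + b + 1)) * (t : ℂ) ^ b * f t‖ ≤
        5 * B * |s| ^ (-(((b : ℝ) + 1) / (k + b + 1 : ℕ)))) := by
  have hB0 : 0 ≤ B := (norm_nonneg _).trans (hB 0)
  set F : ℝ → ℂ := fun t => Complex.exp (I * s * (t : ℂ) ^ (k + b + 1)) * (t : ℂ) ^ b * f t with hF
  have hfc := hf.continuous
  have hFc : Continuous F := by fun_prop
  have hFn : ∀ t : ℝ, 0 ≤ t → ‖F t‖ ≤ B * t ^ b := fun t ht => by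
    have h1 : ‖Complex.exp (I * s * (t : ℂ) ^ (k + b + 1))‖ = 1 := by
      have : I * s * (t : ℂ) ^ (k + b + 1) = ((s * t ^ (k + b + 1) : ℝ) : ℂ) * I := by
        push_cast; ring
      rw [this, Complex.norm_exp_ofReal_mul_I]
    simp only [hF, norm_mul, h1, norm_pow, Complex.norm_real, Real.norm_of_nonneg ht, one_mul]
    rw [mul_comm]
    exact mul_le_mul_of_nonneg_right (hB t) (by positivity)
  have hhead : ∀ δ : ℝ, 0 ≤ δ → ‖∫ t in (0:ℝ)..δ, F t‖ ≤ B * δ ^ (b + 1) := fun δ hδ => by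
    have := intervalIntegral.norm_integral_le_of_norm_le_const (f := F) (a := 0) (b := δ)
      (C := B * δ ^ b) fun t ht => by
        rw [Set.uIoc_of_le hδ] at ht
        refine (hFn t ht.1.le).trans ?_
        have := ht.1.le
        have := ht.2
        gcongr
    rw [sub_zero, abs_of_nonneg hδ] at this
    rwa [pow_succ, ← mul_assoc]
  have hone : ‖∫ t in (0:ℝ)..1, F t‖ ≤ B := by simpa using hhead 1 zero_le_one
  refine ⟨hone, fun hs => ?_⟩
  have hs0 : 0 < |s| := abs_pos.2 hs
  rcases le_or_gt |s| 1 with h1 | h1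
  · refine hone.trans ?_
    have : 1 ≤ |s| ^ (-(((b : ℝ) + 1) / (k + b + 1 : ℕ))) :=
      Real.one_le_rpow_of_pos_of_le_one_of_nonpos hs0 h1 (neg_nonpos.2 (by positivity))
    nlinarith
  · set δ : ℝ := |s| ^ (-(1 / ((k + b + 1 : ℕ) : ℝ))) with hδd
    have hδ : 0 < δ := by positivity
    have hδ1 : δ ≤ 1 := Real.rpow_le_one_of_one_le_of_nonpos h1.le (neg_nonpos.2 (by positivity))
    have hpw : δ ^ (b + 1) = |s| ^ (-(((b : ℝ) + 1) / (k + b + 1 : ℕ))) := by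
      rw [hδd, ← Real.rpow_natCast, ← Real.rpow_mul hs0.le]
      congr 1
      push_cast
      ring
    have hsd : |s| * δ ^ (k + b + 1) = 1 := by
      rw [hδd, ← Real.rpow_natCast, ← Real.rpow_mul hs0.le, neg_mul, one_div,
        inv_mul_cancel₀ (by positivity), Real.rpow_neg_one, mul_inv_cancel₀ hs0.ne']
    have htail := norm_integral_exp_monomial_tail_le (b := b) (k := k) hs hδ hδ1 hf hB hB'
    have h2 : 4 * B / (|s| * δ ^ k) = 4 * B * δ ^ (b + 1) := by
      rw [div_eq_iff (by positivity)]
      linear_combination (-4 * B) * hsd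
    rw [h2] at htail
    rw [← hpw, ← intervalIntegral.integral_add_adjacent_intervals
      (hFc.intervalIntegrable 0 δ) (hFc.intervalIntegrable δ 1)]
    refine (norm_add_le _ _).trans ?_
    have := hhead δ hδ.le
    linarith

/-- Decay of a one-dimensional damped oscillatory integral with amplitude supported in
`[-1, 1]`. -/
theorem norm_integral_exp_monomial_le {a b : ℕ} (hab : b + 1 ≤ a) {s B : ℝ} {f : ℝ → ℂ}
    (hf : ContDiff ℝ 1 f) (hB : ∀ t, ‖f t‖ ≤ B) (hB' : ∀ t, ‖deriv f t‖ ≤ B)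
    (hsupp : ∀ t, t ∉ Set.Icc (-1 : ℝ) 1 → f t = 0) :
    ‖∫ t : ℝ, Complex.exp (I * s * (t : ℂ) ^ a) * (|t| : ℝ) ^ b * f t‖ ≤ 10 * B ∧
    (s ≠ 0 →
      ‖∫ t : ℝ, Complex.exp (I * s * (t : ℂ) ^ a) * (|t| : ℝ) ^ b * f t‖ ≤
        10 * B * |s| ^ (-(((b : ℝ) + 1) / a))) := by
  obtain ⟨k, rfl⟩ : ∃ k, a = k + b + 1 := ⟨a - b - 1, by omega⟩
  have hB0 : 0 ≤ B := (norm_nonneg _).trans (hB 0)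
  set F : ℝ → ℂ := fun t => Complex.exp (I * s * (t : ℂ) ^ (k + b + 1)) * (|t| : ℝ) ^ b * f t
    with hF
  have hfc := hf.continuous
  have hFc : Continuous F := by fun_prop
  have hFs : ∫ t, F t = ∫ t in (-1:ℝ)..1, F t := by
    rw [intervalIntegral.integral_of_le (by norm_num), ← integral_Icc_eq_integral_Ioc,
      setIntegral_eq_integral_of_forall_compl_eq_zero]
    intro t ht
    simp [hF, hsupp t ht]
  have hneg : ∫ t in (-1:ℝ)..0, F t = ∫ t in (0:ℝ)..1, F (-t) := by
    rw [intervalIntegral.integral_comp_neg, neg_zero]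
  have hF1 : ∫ t in (0:ℝ)..1, F t =
      ∫ t in (0:ℝ)..1, Complex.exp (I * s * (t : ℂ) ^ (k + b + 1)) * (t : ℂ) ^ b * f t := by
    refine intervalIntegral.integral_congr fun t ht => ?_
    rw [Set.uIcc_of_le zero_le_one] at ht
    simp only [hF, abs_of_nonneg ht.1]
  set s' : ℝ := s * (-1) ^ (k + b + 1) with hs'
  have hs'a : |s'| = |s| := by simp [hs', abs_mul]
  have hF2 : ∫ t in (0:ℝ)..1, F (-t) =
      ∫ t in (0:ℝ)..1, Complex.exp (I * s' * (t : ℂ) ^ (k + b + 1)) * (t : ℂ) ^ b * f (-t) := by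
    refine intervalIntegral.integral_congr fun t ht => ?_
    rw [Set.uIcc_of_le zero_le_one] at ht
    simp only [hF, abs_neg, abs_of_nonneg ht.1, hs']
    push_cast
    rw [neg_pow (t : ℂ)]
    ring_nf
  have hsplit : ‖∫ t, F t‖ ≤ ‖∫ t in (0:ℝ)..1, F (-t)‖ + ‖∫ t in (0:ℝ)..1, F t‖ := by
    rw [hFs, ← intervalIntegral.integral_add_adjacent_intervals
      (hFc.intervalIntegrable (-1) 0) (hFc.intervalIntegrable 0 1), hneg]
    exact norm_add_le _ _
  have hp := norm_integral_exp_monomial_zero_one_le (b := b) (k := k) (s := s) hf hB hB'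
  have hn := norm_integral_exp_monomial_zero_one_le (b := b) (k := k) (s := s')
    (f := fun t => f (-t)) (hf.comp contDiff_neg) (fun t => hB _)
    (fun t => by rw [deriv_comp_neg, norm_neg]; exact hB' _)
  rw [← hF1] at hp
  rw [← hF2] at hn
  refine ⟨by linarith [hp.1, hn.1], fun hs => ?_⟩
  have h1 := hp.2 hs
  have h2 := hn.2 (abs_pos.1 (hs'a ▸ abs_pos.2 hs))
  rw [hs'a] at h2
  linarith

/-- Integrals of powers truncated at scale `lam⁻¹`: logarithmic growth only for the exponent `-1`. -/
theorem exists_integral_max_abs_rpow_le {c : ℝ} (hc1 : c ≤ 1) :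
    ∃ K : ℝ, 0 < K ∧ ∀ lam : ℝ, 2 ≤ lam →
      ∫ t in Set.Icc (-1 : ℝ) 1, max |t| lam⁻¹ ^ (-c) ≤ K * if c = 1 then Real.log lam else 1 := by
  have key : ∀ lam : ℝ, 2 ≤ lam → ∫ t in Set.Icc (-1 : ℝ) 1, max |t| lam⁻¹ ^ (-c) ≤
      2 * (1 + ∫ t in lam⁻¹..1, t ^ (-c)) := fun lam hlam => by
    have hl : 0 < lam := by linarith
    have hi : 0 < lam⁻¹ := by positivity
    have hi1 : lam⁻¹ ≤ 1 := inv_le_one_of_one_le₀ (by linarith)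
    have hcont : Continuous fun t : ℝ => max |t| lam⁻¹ ^ (-c) :=
      Continuous.rpow_const (by fun_prop) fun t => Or.inl (lt_max_of_lt_right hi).ne'
    have hint := fun x y => hcont.intervalIntegrable (μ := volume) x y
    rw [integral_Icc_eq_integral_Ioc, ← intervalIntegral.integral_of_le (by norm_num),
      ← intervalIntegral.integral_add_adjacent_intervals (hint (-1) 0) (hint 0 1)]
    have hneg : ∫ t in (-1:ℝ)..0, max |t| lam⁻¹ ^ (-c) =
        ∫ t in (0:ℝ)..1, max |t| lam⁻¹ ^ (-c) := by
      have := intervalIntegral.integral_comp_neg (a := 0) (b := 1)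
        fun t : ℝ => max |t| lam⁻¹ ^ (-c)
      simpa using this.symm
    have hhead : ∫ t in (0:ℝ)..lam⁻¹, max |t| lam⁻¹ ^ (-c) ≤ 1 := by
      have h1 : ∫ t in (0:ℝ)..lam⁻¹, max |t| lam⁻¹ ^ (-c) =
          ∫ t in (0:ℝ)..lam⁻¹, lam⁻¹ ^ (-c) := by
        refine intervalIntegral.integral_congr fun t ht => ?_
        rw [Set.uIcc_of_le hi.le] at ht
        rw [abs_of_nonneg ht.1, max_eq_right ht.2]
      rw [h1, intervalIntegral.integral_const, smul_eq_mul, sub_zero]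
      calc lam⁻¹ * lam⁻¹ ^ (-c) ≤ lam⁻¹ * lam⁻¹ ^ (-1 : ℝ) :=
            mul_le_mul_of_nonneg_left
              (Real.rpow_le_rpow_of_exponent_ge hi hi1 (by linarith)) hi.le
        _ = 1 := by rw [Real.rpow_neg_one, mul_inv_cancel₀ hi.ne']
    have htail : ∫ t in lam⁻¹..1, max |t| lam⁻¹ ^ (-c) = ∫ t in lam⁻¹..1, t ^ (-c) := by
      refine intervalIntegral.integral_congr fun t ht => ?_
      rw [Set.uIcc_of_le hi1] at ht
      rw [abs_of_nonneg (hi.le.trans ht.1), max_eq_left ht.1]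
    rw [hneg, ← intervalIntegral.integral_add_adjacent_intervals (hint 0 lam⁻¹) (hint lam⁻¹ 1),
      htail]
    linarith
  have hlog2 : 0 < Real.log 2 := Real.log_pos one_lt_two
  by_cases hc : c = 1
  · refine ⟨2 * (1 / Real.log 2 + 1), by positivity, fun lam hlam => (key lam hlam).trans ?_⟩
    have hl : 0 < lam := by linarith
    simp only [hc, if_true, Real.rpow_neg_one]
    rw [integral_inv_of_pos (by positivity) one_pos, one_div, inv_inv]
    have hll : Real.log 2 ≤ Real.log lam := Real.log_le_log two_pos hlam
    have : 1 ≤ 1 / Real.log 2 * Real.log lam := by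
      rw [div_mul_eq_mul_div, one_mul]; exact (one_le_div hlog2).2 hll
    linarith
  · have hc' : 0 < 1 - c := sub_pos.2 (lt_of_le_of_ne hc1 hc)
    refine ⟨2 * (1 + 1 / (1 - c)), by positivity, fun lam hlam => (key lam hlam).trans ?_⟩
    have hl : 0 < lam := by linarith
    rw [if_neg hc, mul_one, integral_rpow (Or.inl (by linarith)), Real.one_rpow,
      show -c + 1 = 1 - c by ring]
    gcongr
    have : 0 ≤ lam⁻¹ ^ (1 - c) := by positivity
    linarith

/-- The minimum of the trivial and the decaying bound is dominated by a product of truncated powers. -/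
theorem le_mul_prod_max_abs_rpow {ι : Type*} [Fintype ι] {α β : ι → ℕ} {d lam J K : ℝ}
    (hd : 1 ≤ d) (hα : ∀ j, 1 ≤ α j) (hlam : 1 ≤ lam) (hK : 0 ≤ K) {y : ι → ℝ}
    (hy : ∀ j, |y j| ≤ 1) (hJ : J ≤ K * ∏ j, |y j| ^ β j)
    (hJ' : ∏ j, |y j| ^ α j ≠ 0 →
      J ≤ K * (∏ j, |y j| ^ β j) * (lam * ∏ j, |y j| ^ α j) ^ (-d⁻¹)) :
    J ≤ K * lam ^ (-d⁻¹) * ∏ j, max |y j| lam⁻¹ ^ (-max (α j / d - β j) 0) := by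
  classical
  have hl : 0 < lam := by linarith
  have hi : 0 < lam⁻¹ := by positivity
  have hi1 : lam⁻¹ ≤ 1 := inv_le_one_of_one_le₀ hlam
  have hd0 : 0 < d := by linarith
  have hdi : d⁻¹ ≤ 1 := inv_le_one_of_one_le₀ hd
  set G : ι → ℝ := fun j => max |y j| lam⁻¹ ^ (-max (α j / d - β j) 0) with hG
  have hG1 : ∀ j, 1 ≤ G j := fun j =>
    Real.one_le_rpow_of_pos_of_le_one_of_nonpos (lt_max_of_lt_right hi) (max_le (hy j) hi1)
      (neg_nonpos.2 (le_max_right _ _))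
  have hprod1 : ∀ s : Finset ι, 1 ≤ ∏ j ∈ s, G j := fun s => by
    calc (1 : ℝ) = ∏ j ∈ s, 1 := by simp
      _ ≤ ∏ j ∈ s, G j := Finset.prod_le_prod (fun _ _ => zero_le_one) fun j _ => hG1 j
  have hL : 0 < lam ^ (-d⁻¹) := by positivity
  by_cases hsmall : ∃ j, |y j| < lam⁻¹
  · obtain ⟨j, hj⟩ := hsmall
    have hβle : ∏ j, |y j| ^ β j ≤ |y j| ^ β j := by
      rw [← Finset.mul_prod_erase _ _ (mem_univ j)]
      exact mul_le_of_le_one_right (by positivity)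
        (Finset.prod_le_one (fun _ _ => by positivity)
          fun i _ => pow_le_one₀ (abs_nonneg _) (hy i))
    have hGle : G j ≤ ∏ j, G j := by
      rw [← Finset.mul_prod_erase _ _ (mem_univ j)]
      exact le_mul_of_one_le_right (zero_le_one.trans (hG1 j)) (hprod1 _)
    have hmain : |y j| ^ β j ≤ lam ^ (-d⁻¹) * G j := by
      rcases Nat.eq_zero_or_pos (β j) with h0 | h0
      · have hαd : d⁻¹ ≤ α j / d := by
          rw [inv_eq_one_div]
          gcongr
          exact_mod_cast hα j
        have hGj : G j = lam ^ ((α j : ℝ) / d) := by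
          simp only [hG, h0, Nat.cast_zero, sub_zero, max_eq_right hj.le]
          rw [max_eq_left (by positivity), Real.inv_rpow hl.le, Real.rpow_neg hl.le, inv_inv]
        rw [h0, pow_zero, hGj, ← Real.rpow_add hl]
        exact Real.one_le_rpow hlam (by linarith)
      · calc |y j| ^ β j ≤ |y j| := pow_le_of_le_one (abs_nonneg _) (hy j) h0.ne'
          _ ≤ lam ^ (-1 : ℝ) := by rw [Real.rpow_neg_one]; exact hj.le
          _ ≤ lam ^ (-d⁻¹) := Real.rpow_le_rpow_of_exponent_le hlam (by linarith)
          _ ≤ lam ^ (-d⁻¹) * G j := le_mul_of_one_le_right hL.le (hG1 j)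
    rw [mul_assoc]
    refine hJ.trans (mul_le_mul_of_nonneg_left ?_ hK)
    exact hβle.trans (hmain.trans (mul_le_mul_of_nonneg_left hGle hL.le))
  · push Not at hsmall
    have hpos : ∀ j, 0 < |y j| := fun j => hi.trans_le (hsmall j)
    have hαpos : 0 < ∏ j, |y j| ^ α j := Finset.prod_pos fun j _ => pow_pos (hpos j) _
    refine (hJ' hαpos.ne').trans ?_
    rw [Real.mul_rpow hl.le hαpos.le, ← Real.finsetProd_rpow _ _ fun j _ => by positivity]
    have hle : (∏ j, |y j| ^ β j) * ∏ j, (|y j| ^ α j) ^ (-d⁻¹) ≤ ∏ j, G j := by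
      rw [← Finset.prod_mul_distrib]
      refine Finset.prod_le_prod (fun j _ => by positivity) fun j _ => ?_
      simp only [hG, max_eq_left (hsmall j)]
      rw [← Real.rpow_natCast, ← Real.rpow_natCast, ← Real.rpow_mul (hpos j).le,
        ← Real.rpow_add (hpos j)]
      refine Real.rpow_le_rpow_of_exponent_ge (hpos j) (hy j) ?_
      have := le_max_left ((α j : ℝ) / d - β j) 0
      rw [div_eq_mul_inv] at this ⊢
      linarith
    calc K * (∏ j, |y j| ^ β j) * (lam ^ (-d⁻¹) * ∏ j, (|y j| ^ α j) ^ (-d⁻¹))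
        = K * lam ^ (-d⁻¹) * ((∏ j, |y j| ^ β j) * ∏ j, (|y j| ^ α j) ^ (-d⁻¹)) := by ring
      _ ≤ _ := mul_le_mul_of_nonneg_left hle (by positivity)

/-- Uniform `C^1` bounds for the one-variable slices of a compactly supported `C^1` function. -/
theorem exists_slice_bound {n : ℕ} {φ : (Fin n → ℝ) → ℂ} (hφ : ContDiff ℝ 1 φ)
    (hφc : HasCompactSupport φ) (j : Fin n) :
    ∃ B : ℝ, 0 < B ∧ ∀ x : Fin n → ℝ, ContDiff ℝ 1 (fun t => φ (Function.update x j t)) ∧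
      ∀ t, ‖φ (Function.update x j t)‖ ≤ B ∧
        ‖deriv (fun t => φ (Function.update x j t)) t‖ ≤ B := by
  obtain ⟨B₀, hB₀⟩ := hφc.exists_bound_of_continuous hφ.continuous
  obtain ⟨B₁, hB₁⟩ := (hφc.fderiv (𝕜 := ℝ)).exists_bound_of_continuous
    (hφ.continuous_fderiv one_ne_zero)
  refine ⟨max (max B₀ B₁) 1, lt_max_of_lt_right one_pos, fun x => ⟨?_, fun t => ⟨?_, ?_⟩⟩⟩
  · exact hφ.comp (contDiff_update 1 x j)
  · exact (hB₀ _).trans ((le_max_left _ _).trans (le_max_left _ _))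
  · have h := ((hφ.differentiable one_ne_zero (Function.update x j t)).hasFDerivAt).comp_hasDerivAt
      t (hasDerivAt_update x j t)
    have h' : deriv (fun t => φ (Function.update x j t)) t =
      fderiv ℝ φ (Function.update x j t) (Pi.single j 1) := h.deriv
    rw [h']
    refine ((ContinuousLinearMap.le_opNorm _ _).trans ?_).trans
      ((hB₁ (Function.update x j t)).trans ((le_max_right _ _).trans (le_max_left _ _)))
    exact mul_le_of_le_one_right (norm_nonneg _) (by rw [Pi.norm_single, norm_one])

theorem exists_integral_prod_max_abs_rpow_le {ι : Type*} [Fintype ι] {c : ι → ℝ}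
    (hc1 : ∀ j, c j ≤ 1) :
    ∃ K : ℝ, 0 < K ∧ ∀ lam : ℝ, 2 ≤ lam →
      Integrable (fun y : ι → ℝ => ∏ j, (Set.Icc (-1 : ℝ) 1).indicator
        (fun t => max |t| lam⁻¹ ^ (-c j)) (y j)) ∧
      ∫ y : ι → ℝ, ∏ j, (Set.Icc (-1 : ℝ) 1).indicator
        (fun t => max |t| lam⁻¹ ^ (-c j)) (y j) ≤ K * ∏ j, if c j = 1 then Real.log lam else 1 := by
  choose K hK0 hK using fun j => exists_integral_max_abs_rpow_le (hc1 j)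
  refine ⟨∏ j, K j, Finset.prod_pos fun j _ => hK0 j, fun lam hlam => ⟨?_, ?_⟩⟩
  · have hi : 0 < lam⁻¹ := by positivity
    refine Integrable.fintype_prod (f := fun j => (Set.Icc (-1 : ℝ) 1).indicator
        (fun t => max |t| lam⁻¹ ^ (-c j))) fun j => ?_
    refine (integrable_indicator_iff measurableSet_Icc).2 (Continuous.integrableOn_Icc ?_)
    exact Continuous.rpow_const (by fun_prop) fun t => Or.inl (lt_max_of_lt_right hi).ne'
  · rw [integral_fintype_prod_volume_eq_prod (fun j => (Set.Icc (-1 : ℝ) 1).indicator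
        (fun t => max |t| lam⁻¹ ^ (-c j))), ← Finset.prod_mul_distrib]
    refine Finset.prod_le_prod (fun j _ => integral_nonneg fun t => ?_) fun j _ => ?_
    · exact Set.indicator_nonneg (fun t _ => by positivity) t
    · rw [integral_indicator measurableSet_Icc]
      exact hK j lam hlam

open scoped Classical in
/-- Damped oscillatory integral with monomial phase `x^α` and damping `|x^β|`,
case `d ≥ 1`, where `d = max_j α_j/(β_j+1)` and `M` counts maximizers:
`|∫ e^{iλ x^α} |x^β| φ| ≤ C_φ λ^{-1/d} (log λ)^{M-1}`. -/
theorem oscillatory_monomial_damped_d_ge_one (n : ℕ) (α β : Fin n → ℕ)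
    (hα : ∀ j, 1 ≤ α j) (d : ℝ)
    (hub : ∀ j, (α j : ℝ) / (β j + 1) ≤ d)
    (hatt : ∃ j, (α j : ℝ) / (β j + 1) = d)
    (hd1 : 1 ≤ d)
    (M : ℕ) (hM : M = (Finset.univ.filter fun j => (α j : ℝ) / (β j + 1) = d).card)
    (φ : (Fin n → ℝ) → ℂ) (hφ : ContDiff ℝ 1 φ)
    (hsupp : tsupport φ ⊆ Set.pi Set.univ fun _ => Set.Icc (-1:ℝ) 1) :
    ∃ C : ℝ, 0 < C ∧ ∀ lam : ℝ, 2 ≤ lam →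
      ‖∫ x : Fin n → ℝ, Complex.exp (Complex.I * lam * ∏ j, x j ^ α j) *
          (|∏ j, x j ^ β j| : ℝ) * φ x‖ ≤
        C * lam ^ (-1/d) * Real.log lam ^ (M - 1) := by
  classical
  obtain ⟨j₀, hj₀⟩ := hatt
  cases n with
  | zero => exact j₀.elim0
  | succ m =>
  have hd0 : 0 < d := by linarith
  have hφc : HasCompactSupport φ :=
    (isCompact_univ_pi fun _ => isCompact_Icc).of_isClosed_subset (isClosed_tsupport φ) hsupp
  have hφ0 : ∀ x : Fin (m + 1) → ℝ, ∀ j, x j ∉ Set.Icc (-1 : ℝ) 1 → φ x = 0 := fun x j hj =>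
    image_eq_zero_of_notMem_tsupport fun hx => hj (hsupp hx j (Set.mem_univ j))
  have hab : β j₀ + 1 ≤ α j₀ := by
    have h1 : (1 : ℝ) ≤ (α j₀ : ℝ) / (β j₀ + 1) := hj₀ ▸ hd1
    rw [one_le_div (by positivity)] at h1
    exact_mod_cast h1
  have hdinv : ((β j₀ : ℝ) + 1) / α j₀ = d⁻¹ := by rw [← hj₀, inv_div]
  set c : Fin m → ℝ := fun j =>
    max ((α (j₀.succAbove j) : ℝ) / d - β (j₀.succAbove j)) 0 with hc
  have hub' : ∀ j, (α j : ℝ) / d - β j ≤ 1 := fun j => by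
    have h1 := hub j
    rw [div_le_iff₀ (by positivity)] at h1
    rw [sub_le_iff_le_add, div_le_iff₀ hd0]
    linarith
  have hc1 : ∀ j, c j ≤ 1 := fun j => max_le (hub' _) zero_le_one
  have hciff : ∀ j, c j = 1 ↔
      (α (j₀.succAbove j) : ℝ) / (β (j₀.succAbove j) + 1) = d := fun j => by
    have h1 : c j = 1 ↔ (α (j₀.succAbove j) : ℝ) / d - β (j₀.succAbove j) = 1 := by
      simp only [hc]
      constructor
      · intro h
        rcases max_choice ((α (j₀.succAbove j) : ℝ) / d - β (j₀.succAbove j)) 0 with h2 | h2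
        · rw [← h2, h]
        · rw [h2] at h; exact absurd h zero_ne_one
      · intro h
        rw [h, max_eq_left zero_le_one]
    rw [h1, sub_eq_iff_eq_add, div_eq_iff hd0.ne', div_eq_iff (by positivity)]
    constructor <;> intro h <;> linarith
  have hlogM : ∀ L : ℝ, ∏ j, (if c j = 1 then L else 1) = L ^ (M - 1) := fun L => by
    have h1 : M - 1 = ∑ j, if c j = 1 then 1 else 0 := by
      rw [hM, Finset.card_filter, Fin.sum_univ_succAbove _ j₀, if_pos hj₀, Nat.add_sub_cancel_left]
      simp only [hciff]
    rw [h1, ← Finset.prod_pow_eq_pow_sum]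
    refine Finset.prod_congr rfl fun j _ => ?_
    split_ifs <;> simp
  obtain ⟨B, hB0, hB⟩ := exists_slice_bound hφ hφc j₀
  obtain ⟨K, hK0, hK⟩ := exists_integral_prod_max_abs_rpow_le hc1
  refine ⟨10 * B * K, by positivity, fun lam hlam => ?_⟩
  have hl : 0 < lam := by linarith
  obtain ⟨hKi, hKle⟩ := hK lam hlam
  rw [hlogM] at hKle
  set F : (Fin (m + 1) → ℝ) → ℂ := fun x => Complex.exp (I * lam * (∏ j, x j ^ α j : ℝ)) *
    (|∏ j, x j ^ β j| : ℝ) * φ x with hF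
  have hφcont := hφ.continuous
  have hFi : Integrable F :=
    Continuous.integrable_of_hasCompactSupport (by fun_prop) hφc.mul_left
  set e := MeasurableEquiv.piFinSuccAbove (fun _ : Fin (m + 1) => ℝ) j₀ with he
  have hmp : MeasurePreserving e.symm :=
    (volume_preserving_piFinSuccAbove (fun _ : Fin (m + 1) => ℝ) j₀).symm
  have hes : ∀ t y, e.symm (t, y) = Function.update (j₀.insertNth 0 y : Fin (m + 1) → ℝ) j₀ t :=
    fun t y => (Fin.update_insertNth (α := fun _ => ℝ) j₀ 0 t y).symm
  have hFub : ∫ x, F x = ∫ y : Fin m → ℝ, ∫ t : ℝ, F (e.symm (t, y)) := by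
    rw [← hmp.integral_comp' F]
    exact integral_prod_symm (fun z => F (e.symm z))
      ((hmp.integrable_comp_emb e.symm.measurableEmbedding).2 hFi)
  have hbound : ∀ y : Fin m → ℝ, ‖∫ t : ℝ, F (e.symm (t, y))‖ ≤
      10 * B * lam ^ (-d⁻¹) * ∏ j, (Set.Icc (-1 : ℝ) 1).indicator
        (fun t => max |t| lam⁻¹ ^ (-c j)) (y j) := fun y => by
    by_cases hy : ∀ j, y j ∈ Set.Icc (-1 : ℝ) 1
    · simp only [Set.indicator_of_mem (hy _)]
      set s : ℝ := lam * ∏ j, y j ^ α (j₀.succAbove j) with hs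
      have hsabs : |s| = lam * ∏ j, |y j| ^ α (j₀.succAbove j) := by
        rw [hs, abs_mul, abs_of_pos hl, Finset.abs_prod]
        simp only [abs_pow]
      have hslice : ∫ t : ℝ, F (e.symm (t, y)) =
          (∏ j, |y j| ^ β (j₀.succAbove j) : ℝ) *
            ∫ t : ℝ, Complex.exp (I * s * (t : ℂ) ^ α j₀) * (|t| : ℝ) ^ β j₀ *
              φ (Function.update (j₀.insertNth 0 y : Fin (m + 1) → ℝ) j₀ t) := by
        rw [← integral_const_mul]
        refine integral_congr_ae (ae_of_all _ fun t => ?_)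
        simp only [hF, hes, Fin.prod_univ_succAbove _ j₀, Function.update_self,
          Function.update_of_ne (Fin.succAbove_ne _ _), Fin.insertNth_apply_succAbove, hs,
          abs_mul, Finset.abs_prod, abs_pow]
        push_cast
        ring_nf
      have h1d := norm_integral_exp_monomial_le hab (s := s)
        (hB (j₀.insertNth 0 y)).1 (fun t => ((hB (j₀.insertNth 0 y)).2 t).1)
        (fun t => ((hB (j₀.insertNth 0 y)).2 t).2)
        (fun t ht => hφ0 _ j₀ (by rwa [Function.update_self]))
      have hβ0 : 0 ≤ ∏ j, |y j| ^ β (j₀.succAbove j) :=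
        Finset.prod_nonneg fun j _ => by positivity
      rw [hslice, norm_mul, Complex.norm_real, Real.norm_of_nonneg hβ0]
      refine le_mul_prod_max_abs_rpow hd1 (fun j => hα _) (by linarith) (by positivity)
        (fun j => abs_le.2 (hy j)) ?_ fun hne => ?_
      · rw [mul_comm]
        exact mul_le_mul_of_nonneg_right h1d.1 hβ0
      · have h2 := h1d.2 (abs_pos.1 (by rw [hsabs]; positivity))
        rw [hdinv, hsabs] at h2
        refine (mul_le_mul_of_nonneg_left h2 hβ0).trans (le_of_eq ?_)
        ring
    · push Not at hy
      obtain ⟨j, hj⟩ := hy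
      have h0 : ∀ t : ℝ, F (e.symm (t, y)) = 0 := fun t => by
        have : φ (e.symm (t, y)) = 0 := hφ0 _ (j₀.succAbove j) (by
          rwa [hes, Function.update_of_ne (Fin.succAbove_ne _ _), Fin.insertNth_apply_succAbove])
        simp only [hF, this, mul_zero]
      simp only [h0, integral_zero, norm_zero]
      have : 0 ≤ ∏ j, (Set.Icc (-1 : ℝ) 1).indicator
          (fun t => max |t| lam⁻¹ ^ (-c j)) (y j) :=
        Finset.prod_nonneg fun j _ => Set.indicator_nonneg (fun t _ => by positivity) _
      positivity
  have hfin := norm_integral_le_of_norm_le (hKi.const_mul (10 * B * lam ^ (-d⁻¹)))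
    (ae_of_all _ hbound)
  rw [← hFub, integral_const_mul] at hfin
  rw [neg_div, one_div]
  refine hfin.trans ((mul_le_mul_of_nonneg_left hKle (by positivity)).trans (le_of_eq ?_))
  ring
end
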